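/- Set L = N+1 and define on M̃ the functions F^α := η^{αμ} ∂F^c/∂t^μ for 1 ≤ α ≤ N (independent of t^{N+1}) and F^{N+1} := F^o. Then the (N+1)-tuple (F^1,…,F^{N+1}) satisfies the oriented WDVV equations on M̃ if and only if F^c satisfies the closed WDVV equations and F^o satisfies the open WDVV equations associated to F^c. -/

import Mathlib

/-- The partial derivative `∂f/∂t^i` of a function of `n` complex variables. -/
noncomputable def pd {n : ℕ} (i : Fin n) (f : (Fin n → ℂ) → ℂ) : (Fin n → ℂ) → ℂ :=
  fun x => fderiv ℂ f x (Pi.single i 1)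

theorem AnalyticOnNhd.pd {n : ℕ} {f : (Fin n → ℂ) → ℂ} {s : Set (Fin n → ℂ)}
    (hf : AnalyticOnNhd ℂ f s) (i : Fin n) : AnalyticOnNhd ℂ (pd i f) s :=
  fun x hx => (ContinuousLinearMap.apply ℂ ℂ (Pi.single i 1 : Fin n → ℂ)).analyticAt _ |>.comp
    (hf.fderiv x hx)

theorem AnalyticAt.pd_comm {n : ℕ} {f : (Fin n → ℂ) → ℂ} {x : Fin n → ℂ}
    (hf : AnalyticAt ℂ f x) (i j : Fin n) : pd i (pd j f) x = pd j (pd i f) x := by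
  have hd : DifferentiableAt ℂ (fderiv ℂ f) x := hf.fderiv.differentiableAt
  have key : ∀ i j : Fin n, pd i (pd j f) x
      = fderiv ℂ (fderiv ℂ f) x (Pi.single i 1) (Pi.single j 1) := by
    intro i j
    unfold pd
    rw [fderiv_clm_apply hd (differentiableAt_const _)]
    simp
  have hs : IsSymmSndFDerivAt ℂ f x := hf.contDiffAt.isSymmSndFDerivAt_of_omega
  rw [key, key, hs.eq]

theorem Set.EqOn.pd {n : ℕ} {f g : (Fin n → ℂ) → ℂ} {s : Set (Fin n → ℂ)}
    (h : Set.EqOn f g s) (hs : IsOpen s) (i : Fin n) : Set.EqOn (pd i f) (pd i g) s := by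
  intro x hx
  have : f =ᶠ[nhds x] g := h.eventuallyEq_of_mem (hs.mem_nhds hx)
  simp only [_root_.pd, this.fderiv_eq]

theorem pd_sum_const_mul {n : ℕ} {ι : Type*} (u : Finset ι) (a : ι → ℂ)
    {f : ι → (Fin n → ℂ) → ℂ} {x : Fin n → ℂ}
    (hf : ∀ k ∈ u, DifferentiableAt ℂ (f k) x) (i : Fin n) :
    pd i (fun t => ∑ k ∈ u, a k * f k t) x = ∑ k ∈ u, a k * pd i (f k) x := by
  unfold pd
  rw [fderiv_fun_sum fun k hk => (hf k hk).const_mul (a k), _root_.sum_apply]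
  refine Finset.sum_congr rfl fun k hk => ?_
  rw [fderiv_const_mul (hf k hk)]
  simp

theorem pd_zero {n : ℕ} (i : Fin n) : pd i (fun _ => 0) = fun _ => 0 := by
  ext x
  simp [pd]

/-- Pointwise form of the equivalence: `c` stands for the third derivatives of the closed
potential, `o` for the second derivatives of the open potential, `w` for those of the vector
potential, and `g` for the inverse metric. -/
theorem oriented_iff_closed_open_of_tensors {N : ℕ} {g η : Matrix (Fin N) (Fin N) ℂ}
    (hg : ∀ i j, g i j = g j i) (hη : η * g = 1)
    {c : Fin (N + 1) → Fin (N + 1) → Fin (N + 1) → ℂ}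
    (hc₁ : ∀ i j k, c i j k = c j i k) (hc₂ : ∀ i j k, c i j k = c i k j)
    (hc₀ : ∀ j k, c (Fin.last N) j k = 0)
    {o : Fin (N + 1) → Fin (N + 1) → ℂ} (ho : ∀ i j, o i j = o j i)
    {w : Fin (N + 1) → Fin (N + 1) → Fin (N + 1) → ℂ}
    (hw : ∀ (a : Fin N) i j, w a.castSucc i j = ∑ ν : Fin N, g a ν * c i j ν.castSucc)
    (hwl : w (Fin.last N) = o) :
    (∀ α β γ δ : Fin (N + 1),
      ∑ μ, w α β μ * w μ γ δ = ∑ μ, w α γ μ * w μ β δ) ↔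
    ((∀ α β γ δ : Fin N,
      ∑ μ : Fin N, ∑ ν : Fin N, c α.castSucc β.castSucc μ.castSucc * g μ ν *
          c ν.castSucc γ.castSucc δ.castSucc =
      ∑ μ : Fin N, ∑ ν : Fin N, c δ.castSucc β.castSucc μ.castSucc * g μ ν *
          c ν.castSucc γ.castSucc α.castSucc) ∧
    (∀ α β γ : Fin (N + 1),
      (∑ μ : Fin N, ∑ ν : Fin N, c α β μ.castSucc * g μ ν * o ν.castSucc γ)
          + o α β * o (Fin.last N) γ =
      (∑ μ : Fin N, ∑ ν : Fin N, c γ β μ.castSucc * g μ ν * o ν.castSucc α)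
          + o γ β * o (Fin.last N) α)) := by
  have hc₀' : ∀ i k, c i (Fin.last N) k = 0 := fun i k => by rw [hc₁, hc₀]
  -- the contraction of two closed tensors along the inverse metric
  let P : Fin (N + 1) → Fin (N + 1) → Fin (N + 1) → Fin (N + 1) → ℂ := fun i j k l =>
    ∑ μ : Fin N, ∑ ν : Fin N, c i j μ.castSucc * g μ ν * c ν.castSucc k l
  have hopen : ∀ β γ δ, ∑ μ, w (Fin.last N) β μ * w μ γ δ =
      (∑ μ : Fin N, ∑ ν : Fin N, c γ δ μ.castSucc * g μ ν * o ν.castSucc β)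
          + o γ δ * o (Fin.last N) β := by
    intro β γ δ
    rw [Fin.sum_univ_castSucc, Finset.sum_comm, hwl, ho β (Fin.last N), mul_comm (o γ δ)]
    congr 1
    refine Finset.sum_congr rfl fun μ _ => ?_
    rw [hw, Finset.mul_sum]
    refine Finset.sum_congr rfl fun ν _ => ?_
    rw [ho β, hg μ ν]
    ring
  have hclosed : ∀ (a : Fin N) β γ δ, ∑ μ, w a.castSucc β μ * w μ γ δ =
      ∑ ν : Fin N, g a ν * P β ν.castSucc δ γ := by
    intro a β γ δ
    rw [Fin.sum_univ_castSucc]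
    have h0 : w a.castSucc β (Fin.last N) = 0 := by
      rw [hw]
      exact Finset.sum_eq_zero fun ν _ => by rw [hc₀', mul_zero]
    rw [h0, zero_mul, add_zero]
    simp only [P, Finset.mul_sum]
    rw [Finset.sum_comm]
    refine Finset.sum_congr rfl fun μ _ => ?_
    rw [hw, hw, Finset.sum_mul_sum]
    refine Finset.sum_congr rfl fun ν _ => Finset.sum_congr rfl fun ρ _ => ?_
    rw [hc₂ β μ.castSucc, hc₂ γ δ, hc₁ γ, hc₂ ρ.castSucc]
    ring
  constructor
  · intro h
    refine ⟨fun α β γ δ => ?_, fun α β γ => ?_⟩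
    · change P α.castSucc β.castSucc γ.castSucc δ.castSucc =
        P δ.castSucc β.castSucc γ.castSucc α.castSucc
      have hv : g.mulVec (fun ν => P α.castSucc ν.castSucc γ.castSucc δ.castSucc) =
          g.mulVec (fun ν => P δ.castSucc ν.castSucc γ.castSucc α.castSucc) := by
        ext a
        have := h a.castSucc α.castSucc δ.castSucc γ.castSucc
        rwa [hclosed, hclosed] at this
      have hv' := congrArg η.mulVec hv
      rw [Matrix.mulVec_mulVec, Matrix.mulVec_mulVec, hη, Matrix.one_mulVec,
        Matrix.one_mulVec] at hv'
      exact congrFun hv' β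
    · have := h (Fin.last N) γ α β
      rwa [hopen, hopen] at this
  · rintro ⟨hcl, hop⟩ α β γ δ
    have hP₁ : ∀ j k l, P (Fin.last N) j k l = 0 := fun j k l => by simp [P, hc₀]
    have hP₃ : ∀ i j l, P i j (Fin.last N) l = 0 := fun i j l => by simp [P, hc₀']
    have hP₄ : ∀ i j k, P i j k (Fin.last N) = 0 := fun i j k => by
      simp [P, hc₂ _ k (Fin.last N), hc₀']
    induction α using Fin.lastCases with
    | last => rw [hopen, hopen, hop]
    | cast a =>
      rw [hclosed, hclosed]
      refine Finset.sum_congr rfl fun ν _ => congrArg _ ?_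
      induction β using Fin.lastCases with
      | last => rw [hP₁, hP₄]
      | cast b =>
        induction γ using Fin.lastCases with
        | last => rw [hP₁, hP₄]
        | cast d =>
          induction δ using Fin.lastCases with
          | last => rw [hP₃, hP₃]
          | cast e => exact hcl b ν e d

/-- with `F^α := η^{αμ} ∂F^c/∂t^μ` for `1 ≤ α ≤ N` and `F^{N+1} := F^o`, the tuple
`(F^1,…,F^{N+1})` satisfies the oriented WDVV equations on `M̃` iff `F^c` satisfies the closed
WDVV equations and `F^o` the open WDVV equations associated to `F^c`. -/
theorem oriented_WDVV_iff_closed_open_WDVV (N : ℕ) (hN : 1 ≤ N)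
    (η : Matrix (Fin N) (Fin N) ℂ) (hsym : η.IsSymm) (hinv : IsUnit η.det)
    (M : Set (Fin N → ℂ)) (hM : IsOpen M)
    (U : Set ℂ) (hU : IsOpen U)
    (Fc : (Fin N → ℂ) → ℂ) (Fo : (Fin (N + 1) → ℂ) → ℂ)
    (Mt : Set (Fin (N + 1) → ℂ))
    (hMt : Mt = {t | (fun i : Fin N => t i.castSucc) ∈ M ∧ t (Fin.last N) ∈ U})
    (hFc : AnalyticOnNhd ℂ Fc M) (hFo : AnalyticOnNhd ℂ Fo Mt)
    -- `F^c` regarded as a function on `M̃ ⊆ ℂ^{N+1}`, independent of the last coordinate: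
    (Fc' : (Fin (N + 1) → ℂ) → ℂ) (hFc' : Fc' = fun t => Fc fun i : Fin N => t i.castSucc)
    -- the vector potential `(F^1, …, F^{N+1})`:
    (Fv : Fin (N + 1) → (Fin (N + 1) → ℂ) → ℂ)
    (hFv : ∀ α, Fv α =
      if h : (α : ℕ) < N then
        fun t => ∑ μ : Fin N, η⁻¹ ⟨(α : ℕ), h⟩ μ * pd μ.castSucc Fc' t
      else Fo) :
    -- oriented WDVV on M̃
    (∀ t ∈ Mt, ∀ α β γ δ : Fin (N + 1),
        ∑ μ : Fin (N + 1), pd β (pd μ (Fv α)) t * pd γ (pd δ (Fv μ)) t =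
        ∑ μ : Fin (N + 1), pd γ (pd μ (Fv α)) t * pd β (pd δ (Fv μ)) t) ↔
    -- closed WDVV on M̃
    ((∀ t ∈ Mt, ∀ α β γ δ : Fin N,
        ∑ μ : Fin N, ∑ ν : Fin N,
          pd α.castSucc (pd β.castSucc (pd μ.castSucc Fc')) t * η⁻¹ μ ν *
            pd ν.castSucc (pd γ.castSucc (pd δ.castSucc Fc')) t =
        ∑ μ : Fin N, ∑ ν : Fin N,
          pd δ.castSucc (pd β.castSucc (pd μ.castSucc Fc')) t * η⁻¹ μ ν *
            pd ν.castSucc (pd γ.castSucc (pd α.castSucc Fc')) t) ∧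
    -- open WDVV on M̃
     (∀ t ∈ Mt, ∀ α β γ : Fin (N + 1),
        (∑ μ : Fin N, ∑ ν : Fin N,
          pd α (pd β (pd μ.castSucc Fc')) t * η⁻¹ μ ν * pd ν.castSucc (pd γ Fo) t)
          + pd α (pd β Fo) t * pd (Fin.last N) (pd γ Fo) t =
        (∑ μ : Fin N, ∑ ν : Fin N,
          pd γ (pd β (pd μ.castSucc Fc')) t * η⁻¹ μ ν * pd ν.castSucc (pd α Fo) t)
          + pd γ (pd β Fo) t * pd (Fin.last N) (pd α Fo) t)) := by
  let p : (Fin (N + 1) → ℂ) →L[ℂ] (Fin N → ℂ) :=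
    ContinuousLinearMap.pi fun i => ContinuousLinearMap.proj i.castSucc
  have hMto : IsOpen Mt := by
    rw [hMt]
    exact (hM.preimage p.continuous).inter (hU.preimage (continuous_apply (Fin.last N)))
  have hmem : ∀ t ∈ Mt, p t ∈ M := by
    rw [hMt]
    exact fun t ht => ht.1
  have hcomp : Fc' = Fc ∘ p := hFc'
  have hA : AnalyticOnNhd ℂ Fc' Mt := by
    rw [hcomp]
    exact fun t ht => (hFc _ (hmem t ht)).comp (p.analyticAt t)
  have hlast : Set.EqOn (pd (Fin.last N) Fc') (fun _ => 0) Mt := by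
    intro t ht
    have hp : p (Pi.single (Fin.last N) 1) = 0 := by
      ext i
      simp [p]
    rw [hcomp]
    unfold pd
    rw [fderiv_comp t (hFc _ (hmem t ht)).differentiableAt p.differentiableAt]
    simp [hp]
  have hlast₃ : ∀ t ∈ Mt, ∀ j k, pd (Fin.last N) (pd j (pd k Fc')) t = 0 := by
    intro t ht j k
    have h₁ : Set.EqOn (pd (Fin.last N) (pd k Fc')) (fun _ => 0) Mt := by
      intro x hx
      rw [(hA x hx).pd_comm, hlast.pd hMto k hx, pd_zero]
    rw [(hA.pd k t ht).pd_comm, h₁.pd hMto j ht, pd_zero]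
  have hw : ∀ t ∈ Mt, ∀ (a : Fin N) (i j : Fin (N + 1)), pd i (pd j (Fv a.castSucc)) t =
      ∑ ν : Fin N, η⁻¹ a ν * pd i (pd j (pd ν.castSucc Fc')) t := by
    intro t ht a i j
    have hF : Fv a.castSucc = fun t => ∑ μ : Fin N, η⁻¹ a μ * pd μ.castSucc Fc' t := by
      rw [hFv, dif_pos (by simp)]
      rfl
    have h₁ : Set.EqOn (pd j (Fv a.castSucc))
        (fun t => ∑ μ : Fin N, η⁻¹ a μ * pd j (pd μ.castSucc Fc') t) Mt := by
      intro x hx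
      rw [hF]
      exact pd_sum_const_mul _ _ (fun μ _ => (hA.pd _ x hx).differentiableAt) j
    rw [h₁.pd hMto i ht]
    exact pd_sum_const_mul _ _ (fun μ _ => ((hA.pd _).pd _ t ht).differentiableAt) i
  have hwl : Fv (Fin.last N) = Fo := by
    rw [hFv, dif_neg (by simp)]
  have hg : ∀ i j, η⁻¹ i j = η⁻¹ j i := fun i j => hsym.inv.apply j i
  rw [← forall₂_and]
  refine forall₂_congr fun t ht => ?_
  refine oriented_iff_closed_open_of_tensors (g := η⁻¹) (η := η)
    (c := fun i j k => pd i (pd j (pd k Fc')) t) (o := fun i j => pd i (pd j Fo) t)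
    (w := fun a i j => pd i (pd j (Fv a)) t) hg (Matrix.mul_nonsing_inv η hinv)
    (fun i j k => (hA.pd k t ht).pd_comm i j) (fun i j k => ?_) (hlast₃ t ht)
    (fun i j => (hFo t ht).pd_comm i j) (hw t ht) (by rw [hwl])
  exact Set.EqOn.pd (fun x hx => (hA x hx).pd_comm j k) hMto i ht
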